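/- Let K be a field, A a commutative K-algebra, and x₁, …, x_ℓ ∈ A elements which are algebraically dependent over K (i.e., the family (x₁,…,x_ℓ) is not algebraically independent over K: there is a nonzero polynomial Q ∈ K[X₁,…,X_ℓ] with Q(x₁,…,x_ℓ) = 0). Then the sequence (x₁,…,x_ℓ) is singular. -/

import Mathlib

/-- The nested value
`x₁^{m₁}·(x₂^{m₂}·(⋯(x_ℓ^{m_ℓ}·(1 + a_ℓ·x_ℓ) + ⋯) + a₂·x₂) + a₁·x₁)`
associated to the sequence `x₁,…,x_ℓ` (the last argument is `ℓ`; the sequence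
is indexed starting at `1`). -/
def singVal {A : Type*} [CommRing A] (x a : ℕ → A) (m : ℕ → ℕ) : ℕ → A
  | 0 => 1
  | n + 1 =>
      x 1 ^ m 1 *
        (singVal (fun i => x (i + 1)) (fun i => a (i + 1)) (fun i => m (i + 1)) n + a 1 * x 1)

/-- The sequence `x₁,…,x_ℓ` is singular if there exist `a₁,…,a_ℓ` and
`m₁,…,m_ℓ` with
`x₁^{m₁}·(x₂^{m₂}·(⋯(x_ℓ^{m_ℓ}·(1 + a_ℓ·x_ℓ) + ⋯) + a₂·x₂) + a₁·x₁) = 0`. -/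
def IsSingular {A : Type*} [CommRing A] (x : ℕ → A) (ℓ : ℕ) : Prop :=
  ∃ a : ℕ → A, ∃ m : ℕ → ℕ, singVal x a m ℓ = 0

/-- The nested value only depends on the coefficients and exponents of positive index. -/
theorem singVal_congr {A : Type*} [CommRing A] (x : ℕ → A) {a b : ℕ → A} {m k : ℕ → ℕ}
    (hab : ∀ i, a (i + 1) = b (i + 1)) (hmk : ∀ i, m (i + 1) = k (i + 1)) (n : ℕ) :
    singVal x a m n = singVal x b k n := by
  cases n with
  | zero => rfl
  | succ n => simp only [singVal, hab, hmk]

/-- A nested value of the tail of a sequence extends to a nested value of the whole sequence with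
prescribed first coefficient and exponent. -/
theorem exists_singVal_succ_eq {A : Type*} [CommRing A] (x a : ℕ → A) (m : ℕ → ℕ) (n : ℕ)
    (a₁ : A) (m₁ : ℕ) :
    ∃ (b : ℕ → A) (k : ℕ → ℕ),
      singVal x b k (n + 1) = x 1 ^ m₁ * (singVal (fun i => x (i + 1)) a m n + a₁ * x 1) := by
  refine ⟨fun i => if i = 1 then a₁ else a (i - 1), fun i => if i = 1 then m₁ else m (i - 1), ?_⟩
  rw [singVal, singVal_congr (fun i => x (i + 1)) (b := a) (k := m) (by simp) (by simp)]
  simp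

/-- Evaluating a multivariate polynomial at a point is evaluating it in the remaining variables
and then, as a univariate polynomial, in the first one. -/
theorem MvPolynomial.aeval_eq_eval₂_finSuccEquiv {R A : Type*} [CommRing R] [CommRing A]
    [Algebra R A] {n : ℕ} (x : Fin (n + 1) → A) (p : MvPolynomial (Fin (n + 1)) R) :
    aeval x p = (finSuccEquiv R n p).eval₂
      (aeval (R := R) fun i : Fin n => x i.succ) (x 0) := by
  induction p using MvPolynomial.induction_on with
  | C r => simp [finSuccEquiv_apply]
  | add p q hp hq => simp only [map_add, Polynomial.eval₂_add, hp, hq]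
  | mul_X p i hp =>
    rw [map_mul, map_mul, Polynomial.eval₂_mul, hp, aeval_X]
    congr 1
    refine Fin.cases ?_ (fun j => ?_) i
    · simp [finSuccEquiv_X_zero]
    · simp [finSuccEquiv_X_succ]

/-- The value of a nonzero polynomial at a sequence is, up to a nonzero scalar, one of the nested
values of that sequence. -/
theorem exists_aeval_eq_algebraMap_mul_singVal {K A : Type*} [Field K] [CommRing A] [Algebra K A]
    {n : ℕ} (x : ℕ → A) {Q : MvPolynomial (Fin n) K} (hQ : Q ≠ 0) :
    ∃ c : K, c ≠ 0 ∧ ∃ (a : ℕ → A) (m : ℕ → ℕ),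
      MvPolynomial.aeval (fun i : Fin n => x (i.1 + 1)) Q = algebraMap K A c * singVal x a m n := by
  induction n generalizing x with
  | zero =>
    obtain ⟨c, rfl⟩ := MvPolynomial.C_surjective (Fin 0) Q
    refine ⟨c, fun hc => hQ (by simp [hc]), 0, 0, by simp [singVal]⟩
  | succ n ih =>
    have hP : MvPolynomial.finSuccEquiv K n Q ≠ 0 := by simpa using hQ
    obtain ⟨P, hQP, hXP⟩ :=
      Polynomial.exists_eq_pow_rootMultiplicity_mul_and_not_dvd _ hP 0
    rw [Polynomial.C_0, sub_zero] at hQP hXP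
    obtain ⟨c, hc, a, m, ha⟩ := ih (fun i => x (i + 1)) (mt Polynomial.X_dvd_iff.2 hXP)
    obtain ⟨b, k, hb⟩ := exists_singVal_succ_eq x a m n
      (algebraMap K A c⁻¹ *
        P.divX.eval₂ (MvPolynomial.aeval (R := K) fun i : Fin n => x (i.1 + 1 + 1)) (x 1))
      ((MvPolynomial.finSuccEquiv K n Q).rootMultiplicity 0)
    have hcc : algebraMap K A c * algebraMap K A c⁻¹ = 1 := by
      rw [← map_mul, mul_inv_cancel₀ hc, map_one]
    refine ⟨c, hc, b, k, ?_⟩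
    rw [hb, MvPolynomial.aeval_eq_eval₂_finSuccEquiv, hQP, Polynomial.eval₂_mul,
      Polynomial.eval₂_X_pow, ← hQP]
    nth_rw 1 [← P.divX_mul_X_add]
    simp only [Polynomial.eval₂_mul, Polynomial.eval₂_add, Polynomial.eval₂_X, Polynomial.eval₂_C,
      Fin.val_zero, Fin.val_succ, zero_add, RingHom.coe_coe, ha]
    linear_combination (-(x 1 ^ (MvPolynomial.finSuccEquiv K n Q).rootMultiplicity 0 * x 1 *
      P.divX.eval₂ (MvPolynomial.aeval (R := K) fun i : Fin n => x (i.1 + 1 + 1)) (x 1))) * hcc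

/-- In a commutative algebra over a field `K`, a sequence of elements which are
algebraically dependent over `K` is singular. -/
theorem isSingular_of_not_algebraicIndependent {K : Type*} [Field K]
    {A : Type*} [CommRing A] [Algebra K A] (x : ℕ → A) (ℓ : ℕ)
    (h : ¬ AlgebraicIndependent K (fun i : Fin ℓ => x (i.1 + 1))) :
    IsSingular x ℓ := by
  rw [algebraicIndependent_iff] at h
  push Not at h
  obtain ⟨Q, hQ, hQ0⟩ := h
  obtain ⟨c, hc, a, m, hQc⟩ := exists_aeval_eq_algebraMap_mul_singVal x hQ0
  refine ⟨a, m, ((IsUnit.mk0 c hc).map (algebraMap K A)).mul_right_eq_zero.1 ?_⟩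
  rw [← hQc, hQ]
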